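/- There exists a universal constant C > 0 with the following property. Let W* ∈ ℝ^{d×K} be the ground-truth weight matrix, and let the input x be drawn from a Gaussian mixture Σ_{l=1}^L λ_l N(μ_l, Σ_l) with labels y ∈ {0,1} satisfying P(y = 1 | x) = H(W*, x). Then the population risk f̄ is twice differentiable and, for every K×K permutation matrix P and every W ∈ ℝ^{d×K}, ‖∇²f̄(W) − ∇²f̄(W*P)‖ ≤ C · K^{3/2} · ( Σ_{l=1}^L λ_l (‖μ_l‖ + ‖Σ_l‖^{1/2})⁴ · Σ_{l=1}^L λ_l (‖μ_l‖ + ‖Σ_l‖^{1/2})⁸ )^{1/4} · ‖W − W*P‖_F. -/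

import Mathlib

open MeasureTheory ProbabilityTheory RealInnerProductSpace Matrix

/-- The sigmoid function `φ(x) = 1/(1 + exp(−x))`. -/
noncomputable def phi (x : ℝ) : ℝ := 1 / (1 + Real.exp (-x))

/-- The derivative of the sigmoid, `φ' = φ(1−φ)`. -/
noncomputable def phi' (x : ℝ) : ℝ := phi x * (1 - phi x)

/-- The standard Gaussian measure on `ℝ^d` (i.i.d. `N(0,1)` coordinates). -/
noncomputable def stdGaussian (d : ℕ) : Measure (EuclideanSpace ℝ (Fin d)) :=
  (Measure.pi fun _ : Fin d => gaussianReal 0 1).map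
    (WithLp.equiv 2 (Fin d → ℝ)).symm

/-- The Gaussian measure `N(μ, A·Aᵀ)` on `ℝ^d`: the law of `μ + A·z` for a
standard Gaussian vector `z`. -/
noncomputable def gaussianVec {d : ℕ} (μ : EuclideanSpace ℝ (Fin d))
    (A : Matrix (Fin d) (Fin d) ℝ) : Measure (EuclideanSpace ℝ (Fin d)) :=
  (stdGaussian d).map (fun z => μ + Matrix.toEuclideanLin A z)

/-- The Gaussian mixture `Σ_l λ_l · N(μ_l, A_l·A_lᵀ)` on `ℝ^d`. -/
noncomputable def gaussianMixture {d L : ℕ} (lam : Fin L → ℝ)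
    (μ : Fin L → EuclideanSpace ℝ (Fin d)) (A : Fin L → Matrix (Fin d) (Fin d) ℝ) :
    Measure (EuclideanSpace ℝ (Fin d)) :=
  ∑ l, ENNReal.ofReal (lam l) • gaussianVec (μ l) (A l)

/-- The spectral (operator) norm of a matrix, i.e. the operator norm of the
induced linear map between Euclidean spaces. -/
noncomputable def specNorm {d : ℕ} (M : Matrix (Fin d) (Fin d) ℝ) : ℝ :=
  ‖LinearMap.toContinuousLinearMap (Matrix.toEuclideanLin M)‖

/-- The one-hidden-layer network output `H(W, x) = (1/K) Σ_j φ(⟨w_j, x⟩)`, where the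
columns of `W` are `w_j = W(·, j)`. -/
noncomputable def Hnet {d K : ℕ} (W : EuclideanSpace ℝ (Fin d × Fin K))
    (x : EuclideanSpace ℝ (Fin d)) : ℝ :=
  (1 / (K : ℝ)) * ∑ j : Fin K, phi (∑ i : Fin d, W (i, j) * x i)

/-- The population risk `f̄(W) = E_x[−H(W*,x)·log H(W,x) − (1−H(W*,x))·log(1−H(W,x))]`. -/
noncomputable def popRisk {d K : ℕ} (m : Measure (EuclideanSpace ℝ (Fin d)))
    (Wstar : EuclideanSpace ℝ (Fin d × Fin K)) (W : EuclideanSpace ℝ (Fin d × Fin K)) : ℝ :=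
  ∫ x, (-(Hnet Wstar x) * Real.log (Hnet W x)
        - (1 - Hnet Wstar x) * Real.log (1 - Hnet W x)) ∂m

/-- `W·P` for a `K×K` permutation matrix `P`: the matrix whose `j`-th column is the
`π(j)`-th column of `W`. -/
noncomputable def permuteCols {d K : ℕ} (W : EuclideanSpace ℝ (Fin d × Fin K))
    (π : Equiv.Perm (Fin K)) : EuclideanSpace ℝ (Fin d × Fin K) :=
  (WithLp.equiv 2 (Fin d × Fin K → ℝ)).symm (fun p => W (p.1, π p.2))

lemma phi_eq : phi = Real.sigmoid := by
  funext x; simp [phi, Real.sigmoid_def]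

lemma phi_bound (i : ℕ) (hi : i ≤ 3) (x : ℝ) : |iteratedDeriv i Real.sigmoid x| ≤ Real.sigmoid x := by
  have h0 := Real.sigmoid_nonneg x
  have h1 := Real.sigmoid_le_one x
  have e1 : iteratedDeriv 1 Real.sigmoid = fun x => Real.sigmoid x * (1 - Real.sigmoid x) := by
    rw [iteratedDeriv_one, Real.deriv_sigmoid]
  have e2 : iteratedDeriv 2 Real.sigmoid = fun x => Real.sigmoid x * (1 - Real.sigmoid x) * (1 - 2 * Real.sigmoid x) := by
    rw [iteratedDeriv_succ, e1]
    funext y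
    have h := Real.hasDerivAt_sigmoid y
    refine (h.mul (h.const_sub 1)).deriv.trans ?_; ring
  have e3 : iteratedDeriv 3 Real.sigmoid = fun x => Real.sigmoid x * (1 - Real.sigmoid x) * (1 - 6 * Real.sigmoid x + 6 * Real.sigmoid x ^ 2) := by
    rw [iteratedDeriv_succ, e2]
    funext y
    have h := Real.hasDerivAt_sigmoid y
    refine ((h.mul (h.const_sub 1)).mul ((h.const_mul 2).const_sub 1)).deriv.trans ?_
    simp only [Pi.mul_apply]; ring
  interval_cases i
  · simp [abs_of_nonneg h0]
  · rw [e1, abs_le]; constructor <;> nlinarith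
  · simp only [e2]; rw [abs_mul, abs_of_nonneg (by nlinarith)]
    have : |1 - 2 * Real.sigmoid x| ≤ 1 := by rw [abs_le]; constructor <;> nlinarith
    nlinarith [abs_nonneg (1 - 2 * Real.sigmoid x), mul_le_mul_of_nonneg_left this (by nlinarith : 0 ≤ Real.sigmoid x * (1 - Real.sigmoid x))]
  · simp only [e3]; rw [abs_mul, abs_of_nonneg (by nlinarith)]
    have : |1 - 6 * Real.sigmoid x + 6 * Real.sigmoid x ^ 2| ≤ 1 := by
      rw [abs_le]; constructor <;> nlinarith [sq_nonneg (2 * Real.sigmoid x - 1)]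
    nlinarith [mul_le_mul_of_nonneg_left this (by nlinarith : 0 ≤ Real.sigmoid x * (1 - Real.sigmoid x))]

noncomputable def Ssum {K : ℕ} (y : Fin K → ℝ) : ℝ := ∑ j, phi (y j)

lemma phi_contDiff {n : WithTop ℕ∞} : ContDiff ℝ n phi := by
  rw [phi_eq]; exact contDiff_sigmoid.of_le le_top

lemma phi_pos (x : ℝ) : 0 < phi x := by rw [phi_eq]; exact Real.sigmoid_pos x

lemma Ssum_pos {K : ℕ} (hK : 1 ≤ K) (y : Fin K → ℝ) : 0 < Ssum y := by
  have : Nonempty (Fin K) := ⟨⟨0, hK⟩⟩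
  exact Finset.sum_pos (fun j _ => phi_pos _) Finset.univ_nonempty

lemma Ssum_contDiff {K : ℕ} {n : WithTop ℕ∞} : ContDiff ℝ n (Ssum (K := K)) := by
  unfold Ssum
  exact ContDiff.sum fun j _ => phi_contDiff.comp (contDiff_apply ℝ ℝ j)

lemma Ssum_bound {K : ℕ} (i : ℕ) (hi : i ≤ 3) (y : Fin K → ℝ) :
    ‖iteratedFDeriv ℝ i (Ssum (K := K)) y‖ ≤ Ssum y := by
  have : (Ssum (K := K)) = fun y => ∑ j, (phi ∘ (ContinuousLinearMap.proj (R := ℝ) (φ := fun _ : Fin K => ℝ) j)) y := by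
    funext y; rfl
  conv_lhs => rw [this]
  rw [iteratedFDeriv_fun_sum_apply (fun j _ => (phi_contDiff.comp (ContinuousLinearMap.contDiff _)).contDiffAt)]
  refine (norm_sum_le _ _).trans (Finset.sum_le_sum fun j _ => ?_)
  rw [ContinuousLinearMap.iteratedFDeriv_comp_right _ (phi_contDiff (n := i)) _ le_rfl]
  refine (ContinuousMultilinearMap.norm_compContinuousLinearMap_le _ _).trans ?_
  have h1 : ‖ContinuousLinearMap.proj (R := ℝ) (φ := fun _ : Fin K => ℝ) j‖ ≤ 1 :=
    ContinuousLinearMap.opNorm_le_bound _ zero_le_one (fun v => by simpa using norm_le_pi_norm v j)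
  have h2 : ∏ _k : Fin i, ‖ContinuousLinearMap.proj (R := ℝ) (φ := fun _ : Fin K => ℝ) j‖ ≤ 1 :=
    Finset.prod_le_one (fun _ _ => norm_nonneg _) (fun _ _ => h1)
  have h3 : ‖iteratedFDeriv ℝ i phi (y j)‖ ≤ phi (y j) := by
    rw [norm_iteratedFDeriv_eq_norm_iteratedDeriv, phi_eq]; exact phi_bound i hi _
  calc _ ≤ phi (y j) * 1 := mul_le_mul h3 h2 (by positivity) (phi_pos _).le
    _ = _ := mul_one _

noncomputable def gfun {K : ℕ} (y : Fin K → ℝ) : ℝ := Real.log K - Real.log (Ssum y)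

lemma gfun_contDiff {K : ℕ} (hK : 1 ≤ K) {n : WithTop ℕ∞} : ContDiff ℝ n (gfun (K := K)) := by
  unfold gfun
  exact contDiff_const.sub (Ssum_contDiff.log fun y => (Ssum_pos hK y).ne')

lemma log_bound (i : ℕ) (hi : i ≤ 3) : ‖iteratedFDerivWithin ℝ i Real.log (Set.Ioi 0) 1‖ ≤ 2 := by
  rw [iteratedFDerivWithin_of_isOpen i isOpen_Ioi (by simp), norm_iteratedFDeriv_eq_norm_iteratedDeriv]
  have e1 : iteratedDeriv 1 Real.log = fun x => x⁻¹ := by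
    rw [iteratedDeriv_one]; funext x; simp
  have e2 : iteratedDeriv 2 Real.log = fun x => -(x^2)⁻¹ := by
    rw [iteratedDeriv_succ, e1]; funext x; simp
  have e3 : iteratedDeriv 3 Real.log 1 = 2 := by
    rw [iteratedDeriv_succ, e2]
    have := (((hasDerivAt_pow 2 (1:ℝ)).inv (by norm_num)).neg).deriv
    simp only [Pi.neg_def, Pi.inv_def] at this
    rw [this]; norm_num
  interval_cases i
  · simp
  · rw [e1]; norm_num
  · rw [e2]; norm_num
  · rw [e3]; norm_num

lemma gfun_bound {K : ℕ} (hK : 1 ≤ K) (n : ℕ) (hn1 : 1 ≤ n) (hn : n ≤ 3) (y : Fin K → ℝ) :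
    ‖iteratedFDeriv ℝ n (gfun (K := K)) y‖ ≤ 12 := by
  set s := Ssum y with hs
  have hsp : 0 < s := Ssum_pos hK y
  have e : gfun (K := K) = (fun _ => (Real.log K - Real.log s)) + (-(Real.log ∘ (fun z => s⁻¹ • Ssum z))) := by
    funext z
    simp only [gfun, Pi.add_apply, Pi.neg_apply, Function.comp, smul_eq_mul]
    rw [Real.log_mul (by positivity) (Ssum_pos hK z).ne', Real.log_inv]; ring
  have hc : ContDiff ℝ n (fun z : Fin K → ℝ => s⁻¹ • Ssum z) := Ssum_contDiff.const_smul _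
  have hp : ∀ z : Fin K → ℝ, 0 < s⁻¹ • Ssum z := fun z => mul_pos (inv_pos.2 hsp) (Ssum_pos hK z)
  have hc2 : ContDiff ℝ n (Real.log ∘ (fun z : Fin K → ℝ => s⁻¹ • Ssum z)) := hc.log fun z => (hp z).ne'
  have hc3 : ContDiff ℝ n (-(Real.log ∘ (fun z : Fin K → ℝ => s⁻¹ • Ssum z))) := hc2.neg
  rw [e, iteratedFDeriv_add_apply contDiff_const.contDiffAt hc3.contDiffAt,
    iteratedFDeriv_const_of_ne (by omega), iteratedFDeriv_neg]
  simp only [Pi.zero_apply, zero_add, Pi.neg_apply, norm_neg]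
  have := norm_iteratedFDerivWithin_comp_le (𝕜 := ℝ) (g := Real.log) (f := fun z : Fin K → ℝ => s⁻¹ • Ssum z)
    (n := n) (s := Set.univ) (t := Set.Ioi 0) (x := y) (N := n) (C := 2) (D := 1)
    (Real.contDiffOn_log.mono fun z hz => (ne_of_gt hz)) hc.contDiffOn le_rfl
    isOpen_Ioi.uniqueDiffOn uniqueDiffOn_univ (fun z _ => hp z) (Set.mem_univ _)
    (fun i hi => by
      have : s⁻¹ • Ssum y = 1 := by simp [← hs, hsp.ne']
      rw [this]; exact log_bound i (hi.trans hn))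
    (fun i hi1 hi => by
      rw [iteratedFDerivWithin_univ, iteratedFDeriv_const_smul_apply' Ssum_contDiff.contDiffAt, norm_smul, one_pow,
        norm_inv, Real.norm_of_nonneg hsp.le, inv_mul_le_iff₀ hsp, mul_one]
      exact Ssum_bound i (hi.trans hn) y)
  rw [iteratedFDerivWithin_univ] at this
  refine this.trans ?_
  interval_cases n <;> norm_num [Nat.factorial]
lemma stdG_eq (d : ℕ) : _root_.stdGaussian d = ProbabilityTheory.stdGaussian (EuclideanSpace ℝ (Fin d)) := by
  rw [← ProbabilityTheory.map_pi_eq_stdGaussian]; rfl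

lemma gaussianVec_isGaussian {d : ℕ} (μ : EuclideanSpace ℝ (Fin d))
    (A : Matrix (Fin d) (Fin d) ℝ) : IsGaussian (gaussianVec μ A) := by
  have h : (fun x => μ + Matrix.toEuclideanLin A x) =
    (fun x => μ + x) ∘ (LinearMap.toContinuousLinearMap (Matrix.toEuclideanLin A)) := rfl
  unfold gaussianVec
  rw [stdG_eq, h, ← Measure.map_map (measurable_const_add μ) (by fun_prop)]
  infer_instance

noncomputable def c4 : ℝ := ∫ t, t ^ 4 ∂(gaussianReal 0 1)

lemma c4_nonneg : 0 ≤ c4 := integral_nonneg fun t => by positivity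

lemma std_fourth {d : ℕ} (v : EuclideanSpace ℝ (Fin d)) :
    ∫ z, ⟪v, z⟫ ^ 4 ∂(ProbabilityTheory.stdGaussian (EuclideanSpace ℝ (Fin d))) = c4 * ‖v‖ ^ 4 := by
  have h1 := IsGaussian.map_eq_gaussianReal (μ := ProbabilityTheory.stdGaussian (EuclideanSpace ℝ (Fin d))) (innerSL ℝ v)
  rw [variance_dual_stdGaussian, integral_strongDual_stdGaussian, innerSL_apply_norm] at h1
  have h2 : gaussianReal 0 (‖v‖ ^ 2).toNNReal = (gaussianReal 0 1).map (fun t => ‖v‖ * t) := by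
    rw [gaussianReal_map_const_mul]
    congr 1
    · simp
    · rw [mul_one]; ext; simp
  rw [h2] at h1
  have h3 : ∫ z, ⟪v, z⟫ ^ 4 ∂(ProbabilityTheory.stdGaussian (EuclideanSpace ℝ (Fin d))) =
      ∫ t, t ^ 4 ∂((ProbabilityTheory.stdGaussian (EuclideanSpace ℝ (Fin d))).map (innerSL ℝ v)) := by
    rw [integral_map (by fun_prop) (by fun_prop)]; rfl
  rw [h3, h1, integral_map (by fun_prop) (by fun_prop)]
  simp only [mul_pow]
  rw [integral_const_mul, c4, mul_comm]

lemma adj_bound {d : ℕ} (S A : Matrix (Fin d) (Fin d) ℝ) (h : A * Aᵀ = S) (u : EuclideanSpace ℝ (Fin d)) :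
    ∃ v : EuclideanSpace ℝ (Fin d), (∀ z, ⟪u, Matrix.toEuclideanLin A z⟫ = ⟪v, z⟫) ∧
      ‖v‖ ≤ Real.sqrt (specNorm S) * ‖u‖ := by
  have key : ∀ w z, ⟪w, Matrix.toEuclideanLin A z⟫ = ⟪Matrix.toEuclideanLin Aᵀ w, z⟫ := by
    intro w z
    have := LinearMap.adjoint_inner_left (Matrix.toEuclideanLin A) z w
    rw [← Matrix.toEuclideanLin_conjTranspose_eq_adjoint] at this
    simpa using this.symm
  refine ⟨Matrix.toEuclideanLin Aᵀ u, key u, ?_⟩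
  have h1 : ‖Matrix.toEuclideanLin Aᵀ u‖ ^ 2 ≤ specNorm S * ‖u‖ ^ 2 := by
    rw [← real_inner_self_eq_norm_sq, ← key]
    have : Matrix.toEuclideanLin A (Matrix.toEuclideanLin Aᵀ u) = LinearMap.toContinuousLinearMap (Matrix.toEuclideanLin S) u := by
      rw [← h]; simp [Matrix.toLpLin_apply]
    rw [this]
    calc _ ≤ ‖u‖ * ‖LinearMap.toContinuousLinearMap (Matrix.toEuclideanLin S) u‖ := real_inner_le_norm _ _
      _ ≤ ‖u‖ * (specNorm S * ‖u‖) := by gcongr; exact ContinuousLinearMap.le_opNorm _ _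
      _ = _ := by ring
  have h0 : 0 ≤ specNorm S := norm_nonneg _
  refine abs_le_of_sq_le_sq' ?_ (by positivity) |>.2
  rw [mul_pow, Real.sq_sqrt h0]; exact h1

lemma vec_fourth {d : ℕ} (μ : EuclideanSpace ℝ (Fin d)) (S A : Matrix (Fin d) (Fin d) ℝ)
    (h : A * Aᵀ = S) (u : EuclideanSpace ℝ (Fin d)) :
    ∫ x, ⟪u, x⟫ ^ 4 ∂(gaussianVec μ A) ≤ 8 * (1 + c4) * (‖μ‖ + Real.sqrt (specNorm S)) ^ 4 * ‖u‖ ^ 4 := by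
  obtain ⟨v, hv, hvn⟩ := adj_bound S A h u
  have hm : Measurable (fun z : EuclideanSpace ℝ (Fin d) => μ + Matrix.toEuclideanLin A z) :=
    (measurable_const_add μ).comp (LinearMap.toContinuousLinearMap (Matrix.toEuclideanLin A)).measurable
  unfold gaussianVec
  rw [integral_map hm.aemeasurable (by fun_prop), stdG_eq]
  have hint : Integrable (fun z => ⟪v, z⟫ ^ 4) (ProbabilityTheory.stdGaussian (EuclideanSpace ℝ (Fin d))) := by
    have := IsGaussian.memLp_dual (ProbabilityTheory.stdGaussian (EuclideanSpace ℝ (Fin d))) (innerSL ℝ v) 4 (by simp)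
    have := this.integrable_norm_pow (p := 4) (by norm_num)
    refine this.congr (Filter.Eventually.of_forall fun z => ?_)
    simp only [Real.norm_eq_abs, innerSL_apply_apply]
    exact (even_two_mul 2).pow_abs _
  have hle : ∀ z, ⟪u, μ + Matrix.toEuclideanLin A z⟫ ^ 4 ≤ 8 * (⟪u, μ⟫ ^ 4 + ⟪v, z⟫ ^ 4) := by
    intro z
    rw [inner_add_right, hv]
    nlinarith [sq_nonneg (⟪u, μ⟫ - ⟪v, z⟫), sq_nonneg (⟪u, μ⟫ ^ 2 - ⟪v, z⟫ ^ 2), sq_nonneg (⟪u, μ⟫ + ⟪v, z⟫),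
      sq_nonneg ((⟪u, μ⟫ + ⟪v, z⟫)^2), mul_nonneg (sq_nonneg (⟪u, μ⟫ - ⟪v, z⟫)) (sq_nonneg (⟪u, μ⟫ + ⟪v, z⟫)),
      sq_nonneg ((⟪u, μ⟫ - ⟪v, z⟫)^2)]
  have h4 : ⟪u, μ⟫ ^ 4 ≤ ‖μ‖ ^ 4 * ‖u‖ ^ 4 := by
    rw [← (show Even 4 by decide).pow_abs, ← mul_pow, mul_comm ‖μ‖]
    exact pow_le_pow_left₀ (abs_nonneg _) (abs_real_inner_le_norm _ _) _
  have h5 : ‖v‖ ^ 4 ≤ (Real.sqrt (specNorm S)) ^ 4 * ‖u‖ ^ 4 := by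
    rw [← mul_pow]; exact pow_le_pow_left₀ (norm_nonneg _) hvn _
  have h6 : ‖μ‖ ^ 4 ≤ (‖μ‖ + Real.sqrt (specNorm S)) ^ 4 :=
    pow_le_pow_left₀ (norm_nonneg _) (by linarith [Real.sqrt_nonneg (specNorm S)]) _
  have h7 : Real.sqrt (specNorm S) ^ 4 ≤ (‖μ‖ + Real.sqrt (specNorm S)) ^ 4 :=
    pow_le_pow_left₀ (Real.sqrt_nonneg _) (by linarith [norm_nonneg μ]) _
  calc _ ≤ ∫ z, 8 * (⟪u, μ⟫ ^ 4 + ⟪v, z⟫ ^ 4) ∂(ProbabilityTheory.stdGaussian (EuclideanSpace ℝ (Fin d))) :=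
        integral_mono_of_nonneg (Filter.Eventually.of_forall fun z => by positivity)
          (((integrable_const _).add hint).const_mul 8) (Filter.Eventually.of_forall hle)
    _ = 8 * (⟪u, μ⟫ ^ 4 + c4 * ‖v‖ ^ 4) := by
        rw [integral_const_mul, integral_add (integrable_const _) hint, std_fourth]; simp
    _ ≤ 8 * ((‖μ‖ + Real.sqrt (specNorm S)) ^ 4 * ‖u‖ ^ 4 + c4 * ((‖μ‖ + Real.sqrt (specNorm S)) ^ 4 * ‖u‖ ^ 4)) := by
        have := c4_nonneg
        gcongr
        · exact h4.trans (by gcongr)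
        · exact h5.trans (by gcongr)
    _ = _ := by ring

lemma triple_bound {X : Type*} [MeasurableSpace X] (m : Measure X) [IsProbabilityMeasure m]
    (α β γ : X → ℝ) (hα : ∀ x, 0 ≤ α x) (hβ : ∀ x, 0 ≤ β x) (hγ : ∀ x, 0 ≤ γ x)
    (iα : Integrable (fun x => α x ^ 4) m) (iβ : Integrable (fun x => β x ^ 4) m)
    (iγ : Integrable (fun x => γ x ^ 4) m) (D a b c : ℝ) (hD : 0 ≤ D) (ha : 0 ≤ a) (hb : 0 ≤ b) (hc : 0 ≤ c)
    (ka : ∫ x, α x ^ 4 ∂m ≤ D * a ^ 4) (kb : ∫ x, β x ^ 4 ∂m ≤ D * b ^ 4)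
    (kc : ∫ x, γ x ^ 4 ∂m ≤ D * c ^ 4) :
    ∫ x, α x * β x * γ x ∂m ≤ (3 * D + 1) * (a * b * c) := by
  have key : ∀ ε : ℝ, 0 < ε → ∫ x, α x * β x * γ x ∂m ≤ (3 * D + 1) * ((a + ε) * (b + ε) * (c + ε)) := by
    intro ε hε
    have aux : ∀ p q r : ℝ, 0 ≤ p → 0 ≤ q → 0 ≤ r → p * q * r ≤ 1 + p ^ 4 + q ^ 4 + r ^ 4 := by
      intro p q r hp hq hr
      nlinarith [sq_nonneg (p * q - r), sq_nonneg (p ^ 2 - q ^ 2), sq_nonneg (r ^ 2 - 1), sq_nonneg (p ^ 2), sq_nonneg (q^2), sq_nonneg (r^2)]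
    have hb1 : ∀ x, α x * β x * γ x ≤ ((a + ε) * (b + ε) * (c + ε)) *
        (1 + (1 / (a + ε) ^ 4) * α x ^ 4 + (1 / (b + ε) ^ 4) * β x ^ 4 + (1 / (c + ε) ^ 4) * γ x ^ 4) := by
      intro x
      have := aux (α x / (a + ε)) (β x / (b + ε)) (γ x / (c + ε)) (div_nonneg (hα x) (by positivity))
        (div_nonneg (hβ x) (by positivity)) (div_nonneg (hγ x) (by positivity))
      have h2 := mul_le_mul_of_nonneg_left this (by positivity : 0 ≤ (a + ε) * (b + ε) * (c + ε))
      have e1 : (a + ε) * (b + ε) * (c + ε) * (α x / (a + ε) * (β x / (b + ε)) * (γ x / (c + ε))) = α x * β x * γ x := by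
        have : a + ε ≠ 0 := by positivity
        have : b + ε ≠ 0 := by positivity
        have : c + ε ≠ 0 := by positivity
        field_simp
      rw [e1] at h2
      refine h2.trans (le_of_eq ?_)
      simp only [div_pow]; ring
    have h3 := integral_mono_of_nonneg (μ := m) (Filter.Eventually.of_forall fun x => mul_nonneg (mul_nonneg (hα x) (hβ x)) (hγ x))
      ((((integrable_const (1:ℝ)).add (iα.const_mul (1 / (a + ε) ^ 4))).add (iβ.const_mul (1 / (b + ε) ^ 4))).add
        (iγ.const_mul (1 / (c + ε) ^ 4)) |>.const_mul ((a + ε) * (b + ε) * (c + ε))) (Filter.Eventually.of_forall hb1)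
    refine h3.trans ?_
    have i1 : Integrable (fun x => 1 + 1 / (a + ε) ^ 4 * α x ^ 4) m := (integrable_const (1:ℝ)).add (iα.const_mul _)
    have i2 : Integrable (fun x => 1 + 1 / (a + ε) ^ 4 * α x ^ 4 + 1 / (b + ε) ^ 4 * β x ^ 4) m := i1.add (iβ.const_mul _)
    simp only [Pi.add_apply]
    rw [integral_const_mul, integral_add i2 (iγ.const_mul _), integral_add i1 (iβ.const_mul _),
      integral_add (integrable_const _) (iα.const_mul _), integral_const_mul, integral_const_mul, integral_const_mul]
    have st : ∀ I t : ℝ, 0 ≤ t → I ≤ D * t ^ 4 → 1 / (t + ε) ^ 4 * I ≤ D := by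
      intro I t ht hI
      rw [one_div, inv_mul_le_iff₀ (by positivity), mul_comm]
      exact hI.trans (by gcongr; linarith)
    rw [mul_comm (3 * D + 1)]
    refine mul_le_mul_of_nonneg_left ?_ (by positivity)
    have := st _ _ ha ka
    have := st _ _ hb kb
    have := st _ _ hc kc
    simp only [integral_const, probReal_univ, smul_eq_mul, one_mul]
    linarith
  have ht : Filter.Tendsto (fun ε : ℝ => (3 * D + 1) * ((a + ε) * (b + ε) * (c + ε))) (nhdsWithin 0 (Set.Ioi 0))
      (nhds ((3 * D + 1) * ((a + 0) * (b + 0) * (c + 0)))) :=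
    (Continuous.tendsto (by fun_prop) 0).mono_left nhdsWithin_le_nhds
  simp only [add_zero] at ht
  exact ge_of_tendsto ht (by filter_upwards [self_mem_nhdsWithin] with ε hε using key ε hε)

lemma moment_ineq {L : ℕ} (lam s : Fin L → ℝ) (hl : ∀ l, 0 ≤ lam l) (h1 : ∑ l, lam l = 1) (hs : ∀ l, 0 ≤ s l) :
    ∑ l, lam l * s l ^ 3 ≤ ((∑ l, lam l * s l ^ 4) * (∑ l, lam l * s l ^ 8)) ^ ((1 : ℝ) / 4) := by
  set M2 := ∑ l, lam l * s l ^ 2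
  set M3 := ∑ l, lam l * s l ^ 3
  set M4 := ∑ l, lam l * s l ^ 4
  set M8 := ∑ l, lam l * s l ^ 8
  have n : ∀ k, ∀ l, 0 ≤ lam l * s l ^ k := fun k l => mul_nonneg (hl l) (pow_nonneg (hs l) k)
  have p2 : 0 ≤ M2 := Finset.sum_nonneg fun l _ => n 2 l
  have p3 : 0 ≤ M3 := Finset.sum_nonneg fun l _ => n 3 l
  have p4 : 0 ≤ M4 := Finset.sum_nonneg fun l _ => n 4 l
  have a1 : M3 ^ 2 ≤ M2 * M4 := Finset.sum_sq_le_sum_mul_sum_of_sq_le_mul _ (fun l _ => n 2 l) (fun l _ => n 4 l) (fun l _ => le_of_eq (by ring))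
  have a2 : M2 ^ 2 ≤ 1 * M4 := by
    rw [← h1]
    exact Finset.sum_sq_le_sum_mul_sum_of_sq_le_mul _ (fun l _ => hl l) (fun l _ => n 4 l) (fun l _ => le_of_eq (by ring))
  have a3 : M4 ^ 2 ≤ 1 * M8 := by
    rw [← h1]
    exact Finset.sum_sq_le_sum_mul_sum_of_sq_le_mul _ (fun l _ => hl l) (fun l _ => n 8 l) (fun l _ => le_of_eq (by ring))
  have a4 : M3 ^ 4 ≤ M4 * M8 := by
    calc M3 ^ 4 = (M3 ^ 2) ^ 2 := by ring
      _ ≤ (M2 * M4) ^ 2 := by gcongr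
      _ = M2 ^ 2 * M4 ^ 2 := by ring
      _ ≤ (1 * M4) * (1 * M8) := by gcongr
      _ = _ := by ring
  calc M3 = (M3 ^ 4) ^ ((1:ℝ) / 4) := by
        rw [← Real.rpow_natCast, ← Real.rpow_mul p3]; norm_num
    _ ≤ _ := by gcongr
noncomputable def Tmap {d K : ℕ} (x : EuclideanSpace ℝ (Fin d)) :
    EuclideanSpace ℝ (Fin d × Fin K) →L[ℝ] (Fin K → ℝ) :=
  LinearMap.toContinuousLinearMap
    { toFun := fun W j => ∑ i : Fin d, W (i, j) * x i
      map_add' := fun W V => by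
        funext j; simp [add_mul, Finset.sum_add_distrib]
      map_smul' := fun c W => by
        funext j; simp [Finset.mul_sum, mul_assoc] }

lemma Tmap_apply {d K : ℕ} (x : EuclideanSpace ℝ (Fin d)) (W : EuclideanSpace ℝ (Fin d × Fin K)) (j : Fin K) :
    Tmap x W j = ∑ i : Fin d, W (i, j) * x i := rfl

lemma Tmap_neg {d K : ℕ} (x : EuclideanSpace ℝ (Fin d)) (W : EuclideanSpace ℝ (Fin d × Fin K)) :
    Tmap (-x) W = - Tmap x W := by
  funext j; simp [Tmap_apply]

noncomputable def colv {d K : ℕ} (W : EuclideanSpace ℝ (Fin d × Fin K)) (j : Fin K) : EuclideanSpace ℝ (Fin d) :=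
  WithLp.toLp 2 fun i => W (i, j)

lemma Tmap_col {d K : ℕ} (x : EuclideanSpace ℝ (Fin d)) (W : EuclideanSpace ℝ (Fin d × Fin K)) (j : Fin K) :
    Tmap x W j = ⟪colv W j, x⟫ := by
  simp [Tmap_apply, colv, PiLp.inner_apply, mul_comm]

lemma sum_col {d K : ℕ} (W : EuclideanSpace ℝ (Fin d × Fin K)) : ∑ j, ‖colv W j‖ ^ 2 = ‖W‖ ^ 2 := by
  simp only [EuclideanSpace.real_norm_sq_eq, colv]
  rw [Fintype.sum_prod_type_right]

lemma col_le {d K : ℕ} (W : EuclideanSpace ℝ (Fin d × Fin K)) (j : Fin K) : ‖colv W j‖ ≤ ‖W‖ := by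
  refine abs_le_of_sq_le_sq' ?_ (norm_nonneg _) |>.2
  rw [← sum_col]
  exact Finset.single_le_sum (f := fun j => ‖colv W j‖ ^ 2) (fun _ _ => by positivity) (Finset.mem_univ j)

lemma sum_col4 {d K : ℕ} (W : EuclideanSpace ℝ (Fin d × Fin K)) : ∑ j, ‖colv W j‖ ^ 4 ≤ ‖W‖ ^ 4 := by
  calc ∑ j, ‖colv W j‖ ^ 4 ≤ ∑ j, ‖W‖ ^ 2 * ‖colv W j‖ ^ 2 := by
        refine Finset.sum_le_sum fun j _ => ?_
        have := pow_le_pow_left₀ (norm_nonneg _) (col_le W j) 2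
        nlinarith [sq_nonneg ‖colv W j‖]
    _ = _ := by rw [← Finset.mul_sum, sum_col]; ring

lemma Tmap_norm_apply {d K : ℕ} (x : EuclideanSpace ℝ (Fin d)) (W : EuclideanSpace ℝ (Fin d × Fin K)) :
    ‖Tmap x W‖ ≤ ‖x‖ * ‖W‖ := by
  rw [pi_norm_le_iff_of_nonneg (by positivity)]
  intro j
  rw [Tmap_col, mul_comm]
  exact (norm_inner_le_norm _ _).trans (by gcongr; exact col_le W j)

lemma Tmap_norm {d K : ℕ} (x : EuclideanSpace ℝ (Fin d)) :
    ‖(Tmap x : EuclideanSpace ℝ (Fin d × Fin K) →L[ℝ] (Fin K → ℝ))‖ ≤ ‖x‖ :=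
  ContinuousLinearMap.opNorm_le_bound _ (norm_nonneg _) (Tmap_norm_apply x)

lemma Tmap_contDiff {d K : ℕ} {n : WithTop ℕ∞} :
    ContDiff ℝ n (fun q : EuclideanSpace ℝ (Fin d) × EuclideanSpace ℝ (Fin d × Fin K) => Tmap q.1 q.2) := by
  rw [contDiff_pi]
  intro j
  simp only [Tmap_apply]
  fun_prop

lemma Tmap_cont {d K : ℕ} (W : EuclideanSpace ℝ (Fin d × Fin K)) :
    Continuous (fun x : EuclideanSpace ℝ (Fin d) => Tmap x W) :=
  (Tmap_contDiff (n := 0)).continuous.comp (by fun_prop : Continuous fun x => (x, W))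

lemma Hnet_eq {d K : ℕ} (W : EuclideanSpace ℝ (Fin d × Fin K)) (x : EuclideanSpace ℝ (Fin d)) :
    Hnet W x = (1 / (K : ℝ)) * Ssum (Tmap x W) := rfl

lemma phi_neg (t : ℝ) : phi (-t) = 1 - phi t := by
  rw [phi_eq]; exact Real.sigmoid_neg t

lemma one_sub_Hnet {d K : ℕ} (hK : 1 ≤ K) (W : EuclideanSpace ℝ (Fin d × Fin K)) (x : EuclideanSpace ℝ (Fin d)) :
    1 - Hnet W x = (1 / (K : ℝ)) * Ssum (Tmap (-x) W) := by
  rw [Hnet_eq, Tmap_neg]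
  have : Ssum (-(Tmap x W)) = K - Ssum (Tmap x W) := by
    simp [Ssum, phi_neg]
  have hk : (K : ℝ) ≠ 0 := by positivity
  rw [this]; field_simp

lemma log_aux {K : ℕ} (hK : 1 ≤ K) (y : Fin K → ℝ) : Real.log ((1 / (K : ℝ)) * Ssum y) = - gfun y := by
  have hk : (K : ℝ) ≠ 0 := by positivity
  rw [Real.log_mul (by positivity) (Ssum_pos hK y).ne', one_div, Real.log_inv, gfun]; ring

lemma Hnet_mem {d K : ℕ} (hK : 1 ≤ K) (W : EuclideanSpace ℝ (Fin d × Fin K)) (x : EuclideanSpace ℝ (Fin d)) :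
    0 ≤ Hnet W x ∧ 0 ≤ 1 - Hnet W x := by
  rw [one_sub_Hnet hK, Hnet_eq]
  exact ⟨mul_nonneg (by positivity) (Ssum_pos hK _).le, mul_nonneg (by positivity) (Ssum_pos hK _).le⟩

lemma Hnet_contDiff {d K : ℕ} {n : WithTop ℕ∞} (W : EuclideanSpace ℝ (Fin d × Fin K)) : ContDiff ℝ n (Hnet W) := by
  have : Hnet W = fun x => (1 / (K : ℝ)) * Ssum (Tmap x W) := rfl
  rw [this]
  exact contDiff_const.mul (Ssum_contDiff.comp (Tmap_contDiff.comp (by fun_prop : ContDiff ℝ n fun x => (x, W))))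

noncomputable def ell {d K : ℕ} (Ws : EuclideanSpace ℝ (Fin d × Fin K)) (x : EuclideanSpace ℝ (Fin d))
    (W : EuclideanSpace ℝ (Fin d × Fin K)) : ℝ :=
  Hnet Ws x * gfun (Tmap x W) + (1 - Hnet Ws x) * gfun (Tmap (-x) W)

lemma popRisk_eq {d K : ℕ} (hK : 1 ≤ K) (m : Measure (EuclideanSpace ℝ (Fin d)))
    (Ws : EuclideanSpace ℝ (Fin d × Fin K)) : popRisk m Ws = fun W => ∫ x, ell Ws x W ∂m := by
  funext W
  unfold popRisk
  congr 1
  funext x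
  rw [one_sub_Hnet hK W, Hnet_eq W, log_aux hK, log_aux hK, ell]; ring

lemma ell_contDiff {d K : ℕ} (hK : 1 ≤ K) {n : WithTop ℕ∞} (Ws : EuclideanSpace ℝ (Fin d × Fin K)) :
    ContDiff ℝ n (Function.uncurry (ell Ws)) := by
  have h1 : ContDiff ℝ n (fun q : EuclideanSpace ℝ (Fin d) × EuclideanSpace ℝ (Fin d × Fin K) => Hnet Ws q.1) :=
    (Hnet_contDiff Ws).comp contDiff_fst
  have h2 : ContDiff ℝ n (fun q : EuclideanSpace ℝ (Fin d) × EuclideanSpace ℝ (Fin d × Fin K) => Tmap (-q.1) q.2) :=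
    Tmap_contDiff.comp (by fun_prop : ContDiff ℝ n fun q : EuclideanSpace ℝ (Fin d) × EuclideanSpace ℝ (Fin d × Fin K) => (-q.1, q.2))
  exact (h1.mul ((gfun_contDiff hK).comp Tmap_contDiff)).add ((contDiff_const.sub h1).mul ((gfun_contDiff hK).comp h2))

lemma ell_iter {d K : ℕ} (hK : 1 ≤ K) (n : ℕ) (Ws : EuclideanSpace ℝ (Fin d × Fin K)) (x : EuclideanSpace ℝ (Fin d))
    (W : EuclideanSpace ℝ (Fin d × Fin K)) :
    iteratedFDeriv ℝ n (ell Ws x) W =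
      Hnet Ws x • (iteratedFDeriv ℝ n gfun (Tmap x W)).compContinuousLinearMap (fun _ => Tmap x) +
      (1 - Hnet Ws x) • (iteratedFDeriv ℝ n gfun (Tmap (-x) W)).compContinuousLinearMap (fun _ => Tmap (-x)) := by
  have e : ell Ws x = (Hnet Ws x • (gfun ∘ (Tmap x : EuclideanSpace ℝ (Fin d × Fin K) →L[ℝ] (Fin K → ℝ)))) +
      ((1 - Hnet Ws x) • (gfun ∘ (Tmap (-x) : EuclideanSpace ℝ (Fin d × Fin K) →L[ℝ] (Fin K → ℝ)))) := by
    funext W; rfl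
  have c1 : ∀ z, ContDiff ℝ n (gfun ∘ (Tmap z : EuclideanSpace ℝ (Fin d × Fin K) →L[ℝ] (Fin K → ℝ))) :=
    fun z => (gfun_contDiff hK).comp (ContinuousLinearMap.contDiff _)
  have c2 : ContDiff ℝ n (Hnet Ws x • (gfun ∘ (Tmap x : EuclideanSpace ℝ (Fin d × Fin K) →L[ℝ] (Fin K → ℝ)))) := contDiff_const.smul (c1 x)
  have c3 : ContDiff ℝ n ((1 - Hnet Ws x) • (gfun ∘ (Tmap (-x) : EuclideanSpace ℝ (Fin d × Fin K) →L[ℝ] (Fin K → ℝ)))) := contDiff_const.smul (c1 (-x))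
  rw [e, iteratedFDeriv_add_apply c2.contDiffAt c3.contDiffAt, iteratedFDeriv_const_smul_apply (c1 _).contDiffAt,
    iteratedFDeriv_const_smul_apply (c1 _).contDiffAt, ContinuousLinearMap.iteratedFDeriv_comp_right _ (gfun_contDiff hK (n := n)) _ le_rfl,
    ContinuousLinearMap.iteratedFDeriv_comp_right _ (gfun_contDiff hK (n := n)) _ le_rfl]

lemma ell_bound {d K : ℕ} (hK : 1 ≤ K) (n : ℕ) (hn1 : 1 ≤ n) (hn : n ≤ 3) (Ws : EuclideanSpace ℝ (Fin d × Fin K)) (x : EuclideanSpace ℝ (Fin d))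
    (W : EuclideanSpace ℝ (Fin d × Fin K)) :
    ‖iteratedFDeriv ℝ n (ell Ws x) W‖ ≤ 12 * ‖x‖ ^ n := by
  obtain ⟨h0, h1⟩ := Hnet_mem hK Ws x
  have key : ∀ z : EuclideanSpace ℝ (Fin d), ‖(iteratedFDeriv ℝ n gfun (Tmap z W)).compContinuousLinearMap
      (fun _ => (Tmap z : EuclideanSpace ℝ (Fin d × Fin K) →L[ℝ] (Fin K → ℝ)))‖ ≤ 12 * ‖z‖ ^ n := by
    intro z
    refine (ContinuousMultilinearMap.norm_compContinuousLinearMap_le _ _).trans ?_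
    simp only [Finset.prod_const, Finset.card_univ, Fintype.card_fin]
    have := Tmap_norm (K := K) z
    gcongr
    exact gfun_bound hK n hn1 hn _
  have k1 := key x
  have k2 := key (-x)
  rw [norm_neg] at k2
  rw [ell_iter hK]
  refine (norm_add_le _ _).trans ?_
  rw [norm_smul, norm_smul, Real.norm_of_nonneg h0, Real.norm_of_nonneg h1]
  calc _ ≤ Hnet Ws x * (12 * ‖x‖ ^ n) + (1 - Hnet Ws x) * (12 * ‖x‖ ^ n) := by gcongr
    _ = _ := by ring

lemma gfun_lip {K : ℕ} (hK : 1 ≤ K) (y y' : Fin K → ℝ) :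
    ‖iteratedFDeriv ℝ 2 gfun y - iteratedFDeriv ℝ 2 gfun y'‖ ≤ 12 * ‖y - y'‖ := by
  have hd : Differentiable ℝ (iteratedFDeriv ℝ 2 (gfun (K := K))) :=
    (gfun_contDiff hK (n := 3)).differentiable_iteratedFDeriv (by norm_num)
  refine Convex.norm_image_sub_le_of_norm_fderiv_le (𝕜 := ℝ) (s := Set.univ) (fun z _ => hd z) (fun z _ => ?_) convex_univ
    (Set.mem_univ _) (Set.mem_univ _)
  rw [norm_fderiv_iteratedFDeriv]
  exact gfun_bound hK 3 (by norm_num) le_rfl z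

lemma ell_lip {d K : ℕ} (hK : 1 ≤ K) (Ws : EuclideanSpace ℝ (Fin d × Fin K)) (x : EuclideanSpace ℝ (Fin d))
    (W V : EuclideanSpace ℝ (Fin d × Fin K)) (v : Fin 2 → EuclideanSpace ℝ (Fin d × Fin K)) :
    |iteratedFDeriv ℝ 2 (ell Ws x) W v - iteratedFDeriv ℝ 2 (ell Ws x) V v| ≤
      12 * (‖Tmap x (W - V)‖ * ‖Tmap x (v 0)‖ * ‖Tmap x (v 1)‖) := by
  obtain ⟨h0, h1⟩ := Hnet_mem hK Ws x
  have key : ∀ z : EuclideanSpace ℝ (Fin d), |iteratedFDeriv ℝ 2 gfun (Tmap z W) (fun i => Tmap z (v i)) -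
      iteratedFDeriv ℝ 2 gfun (Tmap z V) (fun i => Tmap z (v i))| ≤
      12 * (‖Tmap z (W - V)‖ * ‖Tmap z (v 0)‖ * ‖Tmap z (v 1)‖) := by
    intro z
    rw [← _root_.sub_apply]
    refine (ContinuousMultilinearMap.le_opNorm (iteratedFDeriv ℝ 2 gfun (Tmap z W) - iteratedFDeriv ℝ 2 gfun (Tmap z V)) (fun i => Tmap z (v i))).trans ?_
    rw [Fin.prod_univ_two]
    calc _ ≤ 12 * ‖Tmap z W - Tmap z V‖ * (‖Tmap z (v 0)‖ * ‖Tmap z (v 1)‖) := by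
          gcongr; exact gfun_lip hK _ _
      _ = _ := by rw [map_sub]; ring
  have k1 := key x
  have k2 := key (-x)
  simp only [Tmap_neg (W := W - V), Tmap_neg (W := v 0), Tmap_neg (W := v 1), norm_neg] at k2
  rw [ell_iter hK, ell_iter hK]
  simp only [_root_.add_apply, _root_.smul_apply, smul_eq_mul,
    ContinuousMultilinearMap.compContinuousLinearMap_apply]
  rw [abs_le] at k1 k2 ⊢
  constructor <;> nlinarith [mul_le_mul_of_nonneg_left k1.1 h0, mul_le_mul_of_nonneg_left k1.2 h0, mul_le_mul_of_nonneg_left k2.1 h1, mul_le_mul_of_nonneg_left k2.2 h1]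

lemma param_deriv {X E G : Type*} [NormedAddCommGroup X] [NormedSpace ℝ X] [MeasurableSpace X] [BorelSpace X]
    [SecondCountableTopology X]
    [NormedAddCommGroup E] [NormedSpace ℝ E] [NormedAddCommGroup G] [NormedSpace ℝ G]
    (m : Measure X) (F : X → E → G) (hF : ContDiff ℝ 1 (Function.uncurry F)) (b : X → ℝ) (hb : Integrable b m)
    (hi : ∀ W, Integrable (fun x => F x W) m) (hbd : ∀ x W, ‖fderiv ℝ (F x) W‖ ≤ b x) (W : E) :
    Integrable (fun x => fderiv ℝ (F x) W) m ∧
    HasFDerivAt (fun W => ∫ x, F x W ∂m) (∫ x, fderiv ℝ (F x) W ∂m) W := by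
  have hc : Continuous (fun x => fderiv ℝ (F x) W) :=
    (ContDiff.fderiv (n := 0) hF contDiff_const (by norm_num)).continuous
  have hmeas : AEStronglyMeasurable (fun x => fderiv ℝ (F x) W) m := hc.aestronglyMeasurable
  refine ⟨hb.mono' hmeas (Filter.Eventually.of_forall fun x => hbd x W), ?_⟩
  refine hasFDerivAt_integral_of_dominated_of_fderiv_le (F := fun W x => F x W) (F' := fun W x => fderiv ℝ (F x) W)
    (s := Set.univ) Filter.univ_mem
    (Filter.Eventually.of_forall fun V => (hi V).aestronglyMeasurable) (hi W) hmeas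
    (Filter.Eventually.of_forall fun x V _ => hbd x V) hb (Filter.Eventually.of_forall fun x V _ => ?_)
  have : ContDiff ℝ 1 (F x) := hF.comp (contDiff_prodMk_right x)
  exact (this.differentiable (by norm_num) V).hasFDerivAt

set_option maxSynthPendingDepth 5 in
set_option synthInstance.maxHeartbeats 200000 in
lemma risk_abs {X E : Type*} [NormedAddCommGroup X] [NormedSpace ℝ X] [MeasurableSpace X] [BorelSpace X]
    [SecondCountableTopology X] [NormedAddCommGroup E] [NormedSpace ℝ E]
    (m : Measure X) (f : X → E → ℝ) (f1 : ContDiff ℝ 3 (Function.uncurry f)) (c1 c2 c3 : X → ℝ)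
    (j1 : Integrable c1 m) (j2 : Integrable c2 m) (j3 : Integrable c3 m)
    (k1 : ∀ x W, ‖iteratedFDeriv ℝ 1 (f x) W‖ ≤ c1 x) (k2 : ∀ x W, ‖iteratedFDeriv ℝ 2 (f x) W‖ ≤ c2 x)
    (k3 : ∀ x W, ‖iteratedFDeriv ℝ 3 (f x) W‖ ≤ c3 x) (i0 : ∀ W, Integrable (fun x => f x W) m) :
    ContDiff ℝ 2 (fun W => ∫ x, f x W ∂m) ∧ ∀ W v, Integrable (fun x => iteratedFDeriv ℝ 2 (f x) W v) m ∧
      iteratedFDeriv ℝ 2 (fun W => ∫ x, f x W ∂m) W v = ∫ x, iteratedFDeriv ℝ 2 (f x) W v ∂m := by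
  have f2 : ContDiff ℝ 2 (Function.uncurry (fun x => fderiv ℝ (f x))) :=
    ContDiff.fderiv (f := fun (q : X × E) => f q.1) (m := 3)
      (f1.comp (by fun_prop : ContDiff ℝ 3 fun r : (X × E) × E => (r.1.1, r.2)))
      contDiff_snd (by norm_num)
  have f3 : ContDiff ℝ 1 (Function.uncurry (fun x => fderiv ℝ (fderiv ℝ (f x)))) :=
    ContDiff.fderiv (f := fun (q : X × E) => fderiv ℝ (f q.1)) (m := 2)
      (f2.comp (by fun_prop : ContDiff ℝ 2 fun r : (X × E) × E => (r.1.1, r.2)))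
      contDiff_snd (by norm_num)
  have b1 : ∀ x W, ‖fderiv ℝ (f x) W‖ ≤ c1 x := fun x W => by
    rw [← norm_iteratedFDeriv_one]; exact k1 x W
  have b2 : ∀ x W, ‖fderiv ℝ (fderiv ℝ (f x)) W‖ ≤ c2 x := fun x W => by
    rw [← norm_iteratedFDeriv_one, norm_iteratedFDeriv_fderiv]; exact k2 x W
  have b3 : ∀ x W, ‖fderiv ℝ (fderiv ℝ (fderiv ℝ (f x))) W‖ ≤ c3 x := fun x W => by
    rw [← norm_iteratedFDeriv_one, norm_iteratedFDeriv_fderiv, norm_iteratedFDeriv_fderiv]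
    exact k3 x W
  have P1 := param_deriv m f (f1.of_le (by norm_num)) _ j1 i0 b1
  have P2 := param_deriv m (fun x => fderiv ℝ (f x)) (f2.of_le (by norm_num)) _ j2 (fun W => (P1 W).1) b2
  have P3 := param_deriv m (fun x => fderiv ℝ (fderiv ℝ (f x))) f3 _ j3 (fun W => (P2 W).1) b3
  have D1 : fderiv ℝ (fun W => ∫ x, f x W ∂m) = fun W => ∫ x, fderiv ℝ (f x) W ∂m :=
    funext fun W => (P1 W).2.fderiv
  have D2 : fderiv ℝ (fun W => ∫ x, fderiv ℝ (f x) W ∂m) = fun W => ∫ x, fderiv ℝ (fderiv ℝ (f x)) W ∂m :=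
    funext fun W => (P2 W).2.fderiv
  constructor
  · rw [show (2 : WithTop ℕ∞) = 1 + 1 by norm_num, contDiff_succ_iff_fderiv]
    refine ⟨fun W => (P1 W).2.differentiableAt, by simp, ?_⟩
    rw [D1, contDiff_one_iff_fderiv]
    refine ⟨fun W => (P2 W).2.differentiableAt, ?_⟩
    rw [D2]
    exact continuous_iff_continuousAt.2 fun W => (P3 W).2.continuousAt
  · intro W v
    simp only [iteratedFDeriv_two_apply]
    rw [D1, D2]
    refine ⟨((P2 W).1.apply_continuousLinearMap (v 0)).apply_continuousLinearMap (v 1), ?_⟩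
    rw [ContinuousLinearMap.integral_apply (P2 W).1, ContinuousLinearMap.integral_apply ((P2 W).1.apply_continuousLinearMap (v 0))]

lemma uncurry_right {X E : Type*} [NormedAddCommGroup X] [NormedSpace ℝ X] [NormedAddCommGroup E] [NormedSpace ℝ E]
    {n : WithTop ℕ∞} (f : X → E → ℝ) (h : ContDiff ℝ n (Function.uncurry f)) (x : X) : ContDiff ℝ n (f x) :=
  h.comp (contDiff_prodMk_right x)

lemma uncurry_left {X E : Type*} [NormedAddCommGroup X] [NormedSpace ℝ X] [NormedAddCommGroup E] [NormedSpace ℝ E]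
    {n : WithTop ℕ∞} (f : X → E → ℝ) (h : ContDiff ℝ n (Function.uncurry f)) (W : E) : Continuous (fun x => f x W) :=
  h.continuous.comp (by fun_prop : Continuous fun x => (x, W))

lemma risk_main {d K : ℕ} (hK : 1 ≤ K) (m : Measure (EuclideanSpace ℝ (Fin d))) [IsFiniteMeasure m]
    (hm : ∀ n : ℕ, Integrable (fun x => ‖x‖ ^ n) m) (Ws : EuclideanSpace ℝ (Fin d × Fin K)) :
    ContDiff ℝ 2 (popRisk m Ws) ∧ ∀ W v, Integrable (fun x => iteratedFDeriv ℝ 2 (ell Ws x) W v) m ∧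
      iteratedFDeriv ℝ 2 (popRisk m Ws) W v = ∫ x, iteratedFDeriv ℝ 2 (ell Ws x) W v ∂m := by
  have f1 : ContDiff ℝ 3 (Function.uncurry (ell Ws)) := ell_contDiff hK Ws
  have b1 : ∀ x W, ‖fderiv ℝ (ell Ws x) W‖ ≤ 12 * ‖x‖ ^ 1 := fun x W => by
    rw [← norm_iteratedFDeriv_one]; exact ell_bound hK 1 le_rfl (by norm_num) Ws x W
  have i0 : ∀ W, Integrable (fun x => ell Ws x W) m := by
    intro W
    have hb : Integrable (fun x => 12 * ‖x‖ ^ 1 * ‖W - 0‖ + ‖gfun (0 : Fin K → ℝ)‖) m :=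
      (((hm 1).const_mul 12).mul_const _).add (integrable_const _)
    refine hb.mono' ((uncurry_left _ f1 W).aestronglyMeasurable)
      (Filter.Eventually.of_forall fun x => ?_)
    have hd : ContDiff ℝ 3 (ell Ws x) := uncurry_right _ f1 x
    have := Convex.norm_image_sub_le_of_norm_fderiv_le (𝕜 := ℝ) (s := Set.univ)
      (fun z _ => hd.differentiable (by norm_num) z) (fun z _ => b1 x z) convex_univ (Set.mem_univ 0) (Set.mem_univ W)
    have e0 : ell Ws x 0 = gfun (0 : Fin K → ℝ) := by
      unfold ell; rw [map_zero, map_zero]; ring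
    rw [e0] at this
    calc ‖ell Ws x W‖ = ‖(ell Ws x W - gfun (0 : Fin K → ℝ)) + gfun (0 : Fin K → ℝ)‖ := by rw [sub_add_cancel]
      _ ≤ _ := (norm_add_le _ _).trans (by gcongr)
  rw [popRisk_eq hK]
  exact risk_abs m (ell Ws) f1 _ _ _ ((hm 1).const_mul 12) ((hm 2).const_mul 12) ((hm 3).const_mul 12)
    (ell_bound hK 1 le_rfl (by norm_num) Ws) (ell_bound hK 2 (by norm_num) (by norm_num) Ws)
    (ell_bound hK 3 (by norm_num) (by norm_num) Ws) i0
lemma gv_pow {d : ℕ} (μ : EuclideanSpace ℝ (Fin d)) (A : Matrix (Fin d) (Fin d) ℝ) (n : ℕ) :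
    Integrable (fun x => ‖x‖ ^ n) (gaussianVec μ A) := by
  have := gaussianVec_isGaussian μ A
  have h := (IsGaussian.memLp_id (gaussianVec μ A) n (by simp)).integrable_norm_pow'
  simpa using h

lemma mix_integrable {d L : ℕ} (lam : Fin L → ℝ) (μ : Fin L → EuclideanSpace ℝ (Fin d))
    (A : Fin L → Matrix (Fin d) (Fin d) ℝ) (f : EuclideanSpace ℝ (Fin d) → ℝ)
    (h : ∀ l, Integrable f (gaussianVec (μ l) (A l))) : Integrable f (gaussianMixture lam μ A) := by
  unfold gaussianMixture
  rw [integrable_finsetSum_measure]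
  exact fun l _ => (h l).smul_measure (by simp)

lemma mix_integral {d L : ℕ} (lam : Fin L → ℝ) (hl : ∀ l, 0 ≤ lam l) (μ : Fin L → EuclideanSpace ℝ (Fin d))
    (A : Fin L → Matrix (Fin d) (Fin d) ℝ) (f : EuclideanSpace ℝ (Fin d) → ℝ)
    (h : ∀ l, Integrable f (gaussianVec (μ l) (A l))) :
    ∫ x, f x ∂(gaussianMixture lam μ A) = ∑ l, lam l * ∫ x, f x ∂(gaussianVec (μ l) (A l)) := by
  unfold gaussianMixture
  rw [integral_finsetSum_measure fun l _ => (h l).smul_measure (by simp)]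
  refine Finset.sum_congr rfl fun l _ => ?_
  rw [integral_smul_measure, ENNReal.toReal_ofReal (hl l), smul_eq_mul]

lemma T4_int {d K : ℕ} (μ : EuclideanSpace ℝ (Fin d)) (A : Matrix (Fin d) (Fin d) ℝ)
    (U : EuclideanSpace ℝ (Fin d × Fin K)) : Integrable (fun x => ‖Tmap x U‖ ^ 4) (gaussianVec μ A) := by
  refine ((gv_pow μ A 4).mul_const (‖U‖ ^ 4)).mono' ((Tmap_cont U).norm.pow 4).aestronglyMeasurable
    (Filter.Eventually.of_forall fun x => ?_)
  rw [Real.norm_of_nonneg (by positivity), ← mul_pow]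
  exact pow_le_pow_left₀ (norm_nonneg _) (Tmap_norm_apply x U) 4

lemma T4_bound {d K : ℕ} (μ : EuclideanSpace ℝ (Fin d)) (S A : Matrix (Fin d) (Fin d) ℝ) (h : A * Aᵀ = S)
    (U : EuclideanSpace ℝ (Fin d × Fin K)) :
    ∫ x, ‖Tmap x U‖ ^ 4 ∂(gaussianVec μ A) ≤
      8 * (1 + c4) * ((‖μ‖ + Real.sqrt (specNorm S)) * ‖U‖) ^ 4 := by
  have hc := c4_nonneg
  have ij : ∀ j, Integrable (fun x => ⟪colv U j, x⟫ ^ 4) (gaussianVec μ A) := by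
    intro j
    refine ((gv_pow μ A 4).const_mul (‖colv U j‖ ^ 4)).mono' (by fun_prop) (Filter.Eventually.of_forall fun x => ?_)
    rw [norm_pow, ← mul_pow]
    exact pow_le_pow_left₀ (norm_nonneg _) (norm_inner_le_norm _ _) 4
  have hle : ∀ x, ‖Tmap x U‖ ^ 4 ≤ ∑ j, ⟪colv U j, x⟫ ^ 4 := by
    intro x
    have hn : ∀ j, 0 ≤ ⟪colv U j, x⟫ ^ 4 := fun j => (show Even 4 by decide).pow_nonneg _
    have h0 : 0 ≤ ∑ j, ⟪colv U j, x⟫ ^ 4 := Finset.sum_nonneg fun j _ => hn j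
    set R := ∑ j, ⟪colv U j, x⟫ ^ 4 with hR
    have h1 : ‖Tmap x U‖ ≤ R ^ ((1:ℝ) / 4) := by
      rw [pi_norm_le_iff_of_nonneg (by positivity)]
      intro j
      rw [Tmap_col]
      have : ‖⟪colv U j, x⟫‖ ^ 4 ≤ R := by
        rw [Real.norm_eq_abs, (show Even 4 by decide).pow_abs]
        exact Finset.single_le_sum (f := fun j => ⟪colv U j, x⟫ ^ 4) (fun j _ => hn j) (Finset.mem_univ j)
      calc ‖⟪colv U j, x⟫‖ = (‖⟪colv U j, x⟫‖ ^ 4) ^ ((1:ℝ) / 4) := by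
            rw [← Real.rpow_natCast, ← Real.rpow_mul (norm_nonneg _)]; norm_num
        _ ≤ _ := by gcongr
    calc ‖Tmap x U‖ ^ 4 ≤ (R ^ ((1:ℝ) / 4)) ^ 4 := pow_le_pow_left₀ (norm_nonneg _) h1 4
      _ = R := by rw [← Real.rpow_natCast, ← Real.rpow_mul h0]; norm_num
  calc _ ≤ ∫ x, ∑ j, ⟪colv U j, x⟫ ^ 4 ∂(gaussianVec μ A) :=
        integral_mono (T4_int μ A U) (integrable_finsetSum _ fun j _ => ij j) hle
    _ = ∑ j, ∫ x, ⟪colv U j, x⟫ ^ 4 ∂(gaussianVec μ A) := integral_finsetSum _ fun j _ => ij j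
    _ ≤ ∑ j, 8 * (1 + c4) * (‖μ‖ + Real.sqrt (specNorm S)) ^ 4 * ‖colv U j‖ ^ 4 :=
        Finset.sum_le_sum fun j _ => vec_fourth μ S A h _
    _ = 8 * (1 + c4) * (‖μ‖ + Real.sqrt (specNorm S)) ^ 4 * ∑ j, ‖colv U j‖ ^ 4 := by rw [Finset.mul_sum]
    _ ≤ 8 * (1 + c4) * (‖μ‖ + Real.sqrt (specNorm S)) ^ 4 * ‖U‖ ^ 4 := by gcongr; exact sum_col4 U
    _ = _ := by ring

lemma T3_int {d K : ℕ} (μ : EuclideanSpace ℝ (Fin d)) (A : Matrix (Fin d) (Fin d) ℝ)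
    (U V Y : EuclideanSpace ℝ (Fin d × Fin K)) :
    Integrable (fun x => ‖Tmap x U‖ * ‖Tmap x V‖ * ‖Tmap x Y‖) (gaussianVec μ A) := by
  refine ((gv_pow μ A 3).mul_const (‖U‖ * ‖V‖ * ‖Y‖)).mono'
    (((Tmap_cont U).norm.mul (Tmap_cont V).norm).mul (Tmap_cont Y).norm).aestronglyMeasurable
    (Filter.Eventually.of_forall fun x => ?_)
  rw [Real.norm_of_nonneg (by positivity)]
  calc _ ≤ (‖x‖ * ‖U‖) * (‖x‖ * ‖V‖) * (‖x‖ * ‖Y‖) := by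
        gcongr <;> exact Tmap_norm_apply x _
    _ = _ := by ring

lemma T3_bound {d K : ℕ} (μ : EuclideanSpace ℝ (Fin d)) (S A : Matrix (Fin d) (Fin d) ℝ) (h : A * Aᵀ = S)
    (U V Y : EuclideanSpace ℝ (Fin d × Fin K)) :
    ∫ x, ‖Tmap x U‖ * ‖Tmap x V‖ * ‖Tmap x Y‖ ∂(gaussianVec μ A) ≤
      (3 * (8 * (1 + c4)) + 1) * ((‖μ‖ + Real.sqrt (specNorm S)) ^ 3 * (‖U‖ * ‖V‖ * ‖Y‖)) := by
  have hc := c4_nonneg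
  have := gaussianVec_isGaussian μ A
  have := triple_bound (gaussianVec μ A) (fun x => ‖Tmap x U‖) (fun x => ‖Tmap x V‖) (fun x => ‖Tmap x Y‖)
    (fun x => norm_nonneg _) (fun x => norm_nonneg _) (fun x => norm_nonneg _) (T4_int μ A U) (T4_int μ A V) (T4_int μ A Y)
    (8 * (1 + c4)) ((‖μ‖ + Real.sqrt (specNorm S)) * ‖U‖) ((‖μ‖ + Real.sqrt (specNorm S)) * ‖V‖)
    ((‖μ‖ + Real.sqrt (specNorm S)) * ‖Y‖) (by positivity) (by positivity) (by positivity) (by positivity)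
    (T4_bound μ S A h U) (T4_bound μ S A h V) (T4_bound μ S A h Y)
  refine this.trans (le_of_eq ?_)
  ring

theorem stmt_18 : ∃ C : ℝ, 0 < C ∧
    ∀ (d K L : ℕ), 1 ≤ d → 1 ≤ K → 1 ≤ L →
    ∀ (lam : Fin L → ℝ), (∀ l, lam l ∈ Set.Ioo (0 : ℝ) 1) → (∑ l, lam l = 1) →
    ∀ (μ : Fin L → EuclideanSpace ℝ (Fin d)) (S A : Fin L → Matrix (Fin d) (Fin d) ℝ),
    (∀ l, (S l).PosSemidef) → (∀ l, A l * (A l)ᵀ = S l) →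
    ∀ (Wstar : EuclideanSpace ℝ (Fin d × Fin K)),
    ContDiff ℝ 2 (popRisk (gaussianMixture lam μ A) Wstar) ∧
    ∀ (π : Equiv.Perm (Fin K)) (W : EuclideanSpace ℝ (Fin d × Fin K)),
      ‖iteratedFDeriv ℝ 2 (popRisk (gaussianMixture lam μ A) Wstar) W -
        iteratedFDeriv ℝ 2 (popRisk (gaussianMixture lam μ A) Wstar)
          (permuteCols Wstar π)‖ ≤
      C * (K : ℝ) ^ ((3 : ℝ) / 2) *
        ((∑ l, lam l * (‖μ l‖ + Real.sqrt (specNorm (S l))) ^ 4) *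
          (∑ l, lam l * (‖μ l‖ + Real.sqrt (specNorm (S l))) ^ 8)) ^ ((1 : ℝ) / 4) *
        ‖W - permuteCols Wstar π‖ := by
  have hc := c4_nonneg
  refine ⟨12 * (3 * (8 * (1 + c4)) + 1), by positivity, ?_⟩
  intro d K L hd hK hL lam hlam hsum μ S A hS hA Ws
  have hl : ∀ l, 0 ≤ lam l := fun l => (hlam l).1.le
  have hpow : ∀ n : ℕ, Integrable (fun x => ‖x‖ ^ n) (gaussianMixture lam μ A) :=
    fun n => mix_integrable lam μ A _ fun l => gv_pow _ _ n
  have hfin : IsFiniteMeasure (gaussianMixture lam μ A) := by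
    have := mix_integrable lam μ A (fun _ => (1 : ℝ)) fun l => by
      have := gaussianVec_isGaussian (μ l) (A l)
      exact integrable_const _
    exact (integrable_const_iff_isFiniteMeasure one_ne_zero).1 this
  obtain ⟨hcd, hit⟩ := risk_main hK (gaussianMixture lam μ A) hpow Ws
  refine ⟨hcd, fun π W => ?_⟩
  set V := permuteCols Ws π
  set M := ((∑ l, lam l * (‖μ l‖ + Real.sqrt (specNorm (S l))) ^ 4) *
          (∑ l, lam l * (‖μ l‖ + Real.sqrt (specNorm (S l))) ^ 8)) ^ ((1 : ℝ) / 4) with hM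
  have hM3 : ∑ l, lam l * (‖μ l‖ + Real.sqrt (specNorm (S l))) ^ 3 ≤ M :=
    moment_ineq lam _ hl hsum fun l => by positivity
  have hM0 : 0 ≤ M := le_trans (Finset.sum_nonneg fun l _ => mul_nonneg (hl l) (by positivity)) hM3
  have hK1 : (1 : ℝ) ≤ (K : ℝ) ^ ((3 : ℝ) / 2) := Real.one_le_rpow (by exact_mod_cast hK) (by norm_num)
  refine ContinuousMultilinearMap.opNorm_le_bound (by positivity) fun v => ?_
  rw [_root_.sub_apply, (hit W v).2, (hit V v).2, ← integral_sub (hit W v).1 (hit V v).1, Fin.prod_univ_two]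
  have i3 := mix_integrable lam μ A _ fun l => T3_int (μ l) (A l) (W - V) (v 0) (v 1)
  calc _ ≤ ∫ x, 12 * (‖Tmap x (W - V)‖ * ‖Tmap x (v 0)‖ * ‖Tmap x (v 1)‖) ∂(gaussianMixture lam μ A) :=
        norm_integral_le_of_norm_le (i3.const_mul 12) (Filter.Eventually.of_forall fun x => ell_lip hK Ws x W V v)
    _ = 12 * ∑ l, lam l * ∫ x, ‖Tmap x (W - V)‖ * ‖Tmap x (v 0)‖ * ‖Tmap x (v 1)‖ ∂(gaussianVec (μ l) (A l)) := by
        rw [integral_const_mul, mix_integral lam hl μ A _ fun l => T3_int (μ l) (A l) (W - V) (v 0) (v 1)]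
    _ ≤ 12 * ∑ l, lam l * ((3 * (8 * (1 + c4)) + 1) *
          ((‖μ l‖ + Real.sqrt (specNorm (S l))) ^ 3 * (‖W - V‖ * ‖v 0‖ * ‖v 1‖))) := by
        gcongr with l _
        · exact hl l
        · exact T3_bound (μ l) (S l) (A l) (hA l) _ _ _
    _ = 12 * (3 * (8 * (1 + c4)) + 1) * 1 * (∑ l, lam l * (‖μ l‖ + Real.sqrt (specNorm (S l))) ^ 3) *
          ‖W - V‖ * (‖v 0‖ * ‖v 1‖) := by
        simp only [Finset.mul_sum, Finset.sum_mul]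
        exact Finset.sum_congr rfl fun l _ => by ring
    _ ≤ _ := by
        have hs0 : 0 ≤ ∑ l, lam l * (‖μ l‖ + Real.sqrt (specNorm (S l))) ^ 3 :=
          Finset.sum_nonneg fun l _ => mul_nonneg (hl l) (by positivity)
        gcongr
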